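/- arXiv:2306.04772 — 12 statements merged into one kernel-verified Lean document; each statement's English description precedes it below -/
import Mathlib

section
/- Let a, b, c ∈ ℝ with a ≠ 0. Then the zero set of the Rössler vector field F_{a,b,c} consists of exactly the two points P_In = (0,0,0) and P_Out = (c−ab, b−c/a, c/a−b); that is, {v ∈ ℝ³ : F_{a,b,c}(v) = 0} = {(0,0,0), (c−ab, b−c/a, c/a−b)}. -/
/-- The Rössler vector field `F_{a,b,c}(x,y,z) = (−y−z, x+ay, bx+z(x−c))` on `ℝ³`. -/
noncomputable def rossler (a b c : ℝ) : ℝ × ℝ × ℝ → ℝ × ℝ × ℝ :=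
  fun v => (-v.2.1 - v.2.2, v.1 + a * v.2.1, b * v.1 + v.2.2 * (v.1 - c))

/-- The zero set of the Rössler vector field consists of exactly the two points
`P_In = (0,0,0)` and `P_Out = (c−ab, b−c/a, c/a−b)`. -/
theorem stmt_0 (a b c : ℝ) (ha : a ≠ 0) :
    {v : ℝ × ℝ × ℝ | rossler a b c v = 0} =
      ({((0 : ℝ), (0 : ℝ), (0 : ℝ)), (c - a * b, b - c / a, c / a - b)} : Set (ℝ × ℝ × ℝ)) := by
  ext ⟨x, y, z⟩
  simp only [rossler, Set.mem_ofPred_eq, Set.mem_insert_iff, Set.mem_singleton_iff,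
    Prod.mk_eq_zero, Prod.mk.injEq]
  constructor
  · rintro ⟨hyz, hxy, hz⟩
    have hy : y = -z := by linarith
    have hx : x = a * z := by rw [hy] at hxy; linarith
    have hprod : z * (a * z - (c - a * b)) = 0 := by rw [hx] at hz; linear_combination hz
    rcases mul_eq_zero.mp hprod with h0 | h1
    · left
      simp [hx, hy, h0]
    · right
      have hz' : z = c / a - b := by
        field_simp
        linarith
      exact ⟨by linarith, by linarith, hz'⟩
  · rintro (⟨rfl, rfl, rfl⟩ | ⟨rfl, rfl, rfl⟩)
    · simp
    · refine ⟨by ring, ?_, ?_⟩ <;> field_simp <;> ring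
end

section
/- Let a, b, c ∈ ℝ with a ∈ (0,1), b ∈ (0,1), c > 1, and let γ : ℝ → ℝ³ be a nonconstant periodic solution of the Rössler system, i.e., γ'(t) = F_{a,b,c}(γ(t)) for all t, γ is not constant, and there exists T > 0 with γ(t+T) = γ(t) for all t. Then γ intersects the open half-plane H_p transversely at least once: there exists t₀ ∈ ℝ such that γ₁(t₀) + a·γ₂(t₀) = 0 and γ₃(t₀) > γ₁(t₀)/a (so that F_{a,b,c}(γ(t₀)) ⬝ (1,a,0) = γ₁(t₀)/a − γ₃(t₀) < 0). -/
open Set Filter Topology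

theorem HasDerivAt.eventually_lt_nhdsGT {f : ℝ → ℝ} {m t : ℝ} (hf : HasDerivAt f m t)
    (hm : 0 < m) : ∀ᶠ s in 𝓝[>] t, f t < f s := by
  have h := (hasDerivAt_iff_tendsto_slope.mp hf).eventually (eventually_gt_nhds hm)
  filter_upwards [nhdsGT_le_nhdsNE t h, self_mem_nhdsWithin] with s hs (hts : t < s)
  have h' : 0 < slope f t s := hs
  rw [slope_def_field] at h'
  have := (div_pos_iff_of_pos_right (sub_pos.mpr hts)).mp h'
  linarith

theorem eventually_lt_nhdsGT_of_deriv_pos {f f' : ℝ → ℝ} {t : ℝ}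
    (hf : ∀ s, HasDerivAt f (f' s) s) (h : ∀ᶠ s in 𝓝[>] t, 0 < f' s) :
    ∀ᶠ s in 𝓝[>] t, f t < f s := by
  obtain ⟨u, hu, hpos⟩ := mem_nhdsGT_iff_exists_Ioo_subset.mp h
  filter_upwards [Ioo_mem_nhdsGT hu] with s hs
  obtain ⟨r, hr, hslope⟩ := exists_hasDerivAt_eq_slope f f' hs.1
    (fun x _ ↦ (hf x).continuousAt.continuousWithinAt) (fun x _ ↦ hf x)
  have hr0 : 0 < f' r := hpos ⟨hr.1, hr.2.trans hs.2⟩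
  rw [hslope] at hr0
  have := (div_pos_iff_of_pos_right (sub_pos.mpr hs.1)).mp hr0
  linarith

theorem IsLocalMax.second_deriv_nonpos {f f' : ℝ → ℝ} {m t : ℝ} (hmax : IsLocalMax f t)
    (hf : ∀ s, HasDerivAt f (f' s) s) (hf' : HasDerivAt f' m t) : m ≤ 0 := by
  by_contra! hm
  have h0 : f' t = 0 := hmax.hasDerivAt_eq_zero (hf t)
  have h1 := hf'.eventually_lt_nhdsGT hm
  rw [h0] at h1
  obtain ⟨s, hs, hs'⟩ := ((eventually_lt_nhdsGT_of_deriv_pos hf h1).and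
    (hmax.filter_mono nhdsWithin_le_nhds)).exists
  exact hs.not_ge hs'

theorem IsLocalMax.third_deriv_nonpos {f f' f'' : ℝ → ℝ} {m t : ℝ} (hmax : IsLocalMax f t)
    (hf : ∀ s, HasDerivAt f (f' s) s) (hf' : ∀ s, HasDerivAt f' (f'' s) s)
    (hf'' : HasDerivAt f'' m t) (h2 : f'' t = 0) : m ≤ 0 := by
  by_contra! hm
  have h0 : f' t = 0 := hmax.hasDerivAt_eq_zero (hf t)
  have h1 := hf''.eventually_lt_nhdsGT hm
  rw [h2] at h1
  have h3 := eventually_lt_nhdsGT_of_deriv_pos hf' h1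
  rw [h0] at h3
  obtain ⟨s, hs, hs'⟩ := ((eventually_lt_nhdsGT_of_deriv_pos hf h3).and
    (hmax.filter_mono nhdsWithin_le_nhds)).exists
  exact hs.not_ge hs'

theorem IsLocalMax.third_deriv_eq_zero {f f' f'' : ℝ → ℝ} {m t : ℝ} (hmax : IsLocalMax f t)
    (hf : ∀ s, HasDerivAt f (f' s) s) (hf' : ∀ s, HasDerivAt f' (f'' s) s)
    (hf'' : HasDerivAt f'' m t) (h2 : f'' t = 0) : m = 0 := by
  refine le_antisymm (hmax.third_deriv_nonpos hf hf' hf'' h2) ?_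
  have hneg (g : ℝ → ℝ) (k s : ℝ) (hg : HasDerivAt g k (-s)) :
      HasDerivAt (fun x ↦ g (-x)) (-k) s := by
    simpa [Function.comp_def] using hg.comp s (hasDerivAt_neg s)
  have hmax' : IsLocalMax (fun x ↦ f (-x)) (-t) := by
    have hc : Tendsto (fun x : ℝ ↦ -x) (𝓝 (-t)) (𝓝 t) := by
      simpa using (continuous_neg (G := ℝ)).tendsto (-t)
    simpa [IsLocalMax, IsMaxFilter] using hc.eventually hmax
  have key := hmax'.third_deriv_nonpos (f' := fun x ↦ -f' (-x)) (f'' := fun x ↦ f'' (-x))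
    (m := -m) (fun s ↦ hneg f _ s (hf _))
    (fun s ↦ by simpa using (hneg f' _ s (hf' _)).fun_neg)
    (hneg f'' _ _ (by simpa using hf'')) (by simpa using h2)
  linarith

theorem contDiff_rossler (a b c : ℝ) : ContDiff ℝ 1 (rossler a b c) := by
  unfold rossler
  fun_prop

/-- A bounded integral curve of a `C¹` vector field through a zero of the field is constant. -/
theorem eq_const_of_hasDerivAt_of_eq_zero {E : Type*} [NormedAddCommGroup E] [NormedSpace ℝ E]
    [FiniteDimensional ℝ E] {F : E → E} (hF : ContDiff ℝ 1 F) {γ : ℝ → E}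
    (hγ : ∀ t, HasDerivAt γ (F (γ t)) t) (hbdd : Bornology.IsBounded (range γ)) {t₀ : ℝ}
    (h0 : F (γ t₀) = 0) : ∀ t, γ t = γ t₀ := by
  have : ProperSpace E := FiniteDimensional.proper ℝ E
  obtain ⟨R, hR⟩ := hbdd.subset_closedBall 0
  obtain ⟨K, hK⟩ := (hF.contDiffOn (s := Metric.closedBall 0 R)).exists_lipschitzOnWith one_ne_zero
    (convex_closedBall 0 R) (isCompact_closedBall 0 R)
  have h := ODE_solution_unique_univ (v := fun _ ↦ F) (s := fun _ ↦ Metric.closedBall 0 R)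
    (f := γ) (g := fun _ ↦ γ t₀) (t₀ := t₀) (fun _ ↦ hK)
    (fun t ↦ ⟨hγ t, hR (mem_range_self t)⟩)
    (fun t ↦ ⟨by simpa only [h0] using hasDerivAt_const t (γ t₀), hR (mem_range_self t₀)⟩) rfl
  exact fun t ↦ congrFun h t

/-- Every nonconstant periodic solution of the Rössler system intersects the open
half-plane `H_p = {(x, −x/a, z) : z > x/a}` transversely at least once. -/
theorem stmt_2 (a b c : ℝ) (ha : a ∈ Set.Ioo (0 : ℝ) 1) (hb : b ∈ Set.Ioo (0 : ℝ) 1)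
    (hc : 1 < c) (γ : ℝ → ℝ × ℝ × ℝ)
    (hsol : ∀ t : ℝ, HasDerivAt γ (rossler a b c (γ t)) t)
    (hnc : ¬ ∃ v : ℝ × ℝ × ℝ, ∀ t : ℝ, γ t = v)
    (T : ℝ) (hT : 0 < T) (hper : ∀ t : ℝ, γ (t + T) = γ t) :
    ∃ t₀ : ℝ, (γ t₀).1 + a * (γ t₀).2.1 = 0 ∧ (γ t₀).1 / a < (γ t₀).2.2 := by
  have hcont : Continuous γ := continuous_iff_continuousAt.mpr fun t ↦ (hsol t).continuousAt
  have hcomp : IsCompact (range γ) := Function.Periodic.compact_of_continuous hper hT.ne' hcont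
  obtain ⟨_, ⟨t₀, rfl⟩, ht₀⟩ := hcomp.exists_isMaxOn (range_nonempty γ)
    (f := fun v : ℝ × ℝ × ℝ ↦ v.2.1) (by fun_prop)
  have hmax : IsLocalMax (fun t ↦ (γ t).2.1) t₀ :=
    Eventually.of_forall fun t ↦ ht₀ (mem_range_self t)
  have hx (t : ℝ) : HasDerivAt (fun t ↦ (γ t).1) (-(γ t).2.1 - (γ t).2.2) t :=
    (hsol t).fst
  have hy (t : ℝ) : HasDerivAt (fun t ↦ (γ t).2.1) ((γ t).1 + a * (γ t).2.1) t :=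
    (hsol t).snd.fst
  have hz (t : ℝ) : HasDerivAt (fun t ↦ (γ t).2.2)
      (b * (γ t).1 + (γ t).2.2 * ((γ t).1 - c)) t :=
    (hsol t).snd.snd
  have hy' (t : ℝ) := (hx t).fun_add ((hy t).const_mul a)
  have hy'' (t : ℝ) := ((hy t).fun_neg.fun_sub (hz t)).fun_add ((hy' t).const_mul a)
  have h1 : (γ t₀).1 + a * (γ t₀).2.1 = 0 := hmax.hasDerivAt_eq_zero (hy t₀)
  have h2 := hmax.second_deriv_nonpos hy (hy' t₀)
  have hxa : (γ t₀).1 / a = -(γ t₀).2.1 := by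
    rw [div_eq_iff ha.1.ne']
    linarith
  refine ⟨t₀, h1, ?_⟩
  rw [h1] at h2
  by_contra! hle
  have h2' : -(γ t₀).2.1 - (γ t₀).2.2 = 0 := by linarith
  have h3 := hmax.third_deriv_eq_zero hy hy' (hy'' t₀) (by rw [h1, h2']; ring)
  rw [h1, h2'] at h3
  have h3' : b * (γ t₀).1 + (γ t₀).2.2 * ((γ t₀).1 - c) = 0 := by linarith
  refine hnc ⟨γ t₀, eq_const_of_hasDerivAt_of_eq_zero (contDiff_rossler a b c) hsol
    hcomp.isBounded ?_⟩
  simp only [rossler, h1, h2', h3', Prod.mk_zero_zero]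
end

section
/- Let a, b, c ∈ ℝ with a ∈ (0,1), b ∈ (0,1), c > 1. For every x ≠ a+c, the tangent vector σ'(x) = (1, −(b+1)(a+c)/(a+c−x)², (b+1)(a+c)/(a+c−x)²) to the curve σ is not an eigenvector of the Jacobian matrix J_{a,b,c}(P_In) of F_{a,b,c} at P_In = (0,0,0), and is not an eigenvector of the Jacobian matrix J_{a,b,c}(P_Out) at P_Out = (c−ab, b−c/a, c/a−b); that is, for every μ ∈ ℝ, J_{a,b,c}(P_In)·σ'(x) ≠ μ·σ'(x) and J_{a,b,c}(P_Out)·σ'(x) ≠ μ·σ'(x). -/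
/-- The Jacobian matrix of the Rössler vector field `F_{a,b,c}` at the point `(x,y,z)`:
`[[0,−1,−1],[1,a,0],[b+z,0,x−c]]`. -/
noncomputable def rosslerJac (a b c x y z : ℝ) : Matrix (Fin 3) (Fin 3) ℝ :=
  !![0, -1, -1; 1, a, 0; b + z, 0, x - c]

/-- A vector `(1, -s, s)` that the Rössler Jacobian sends to a multiple of itself lies in its
kernel. -/
theorem rosslerJac_mulVec_eq_smul {a b c x y z s μ : ℝ}
    (h : (rosslerJac a b c x y z).mulVec ![1, -s, s] = μ • ![1, -s, s]) :
    a * s = 1 ∧ b + z + (x - c) * s = 0 := by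
  have h0 := congrFun h 0
  have h1 := congrFun h 1
  have h2 := congrFun h 2
  simp [rosslerJac, Matrix.mulVec, dotProduct, Fin.sum_univ_three] at h0 h1 h2
  subst h0
  constructor <;> linarith

/-- The tangent vector `σ'(x) = (1, −(b+1)(a+c)/(a+c−x)², (b+1)(a+c)/(a+c−x)²)` of the
tangency curve `σ` is not an eigenvector of the Jacobian of the Rössler field at
`P_In = (0,0,0)` nor at `P_Out = (c−ab, b−c/a, c/a−b)`. -/
theorem stmt_4 (a b c : ℝ) (ha : a ∈ Set.Ioo (0 : ℝ) 1) (hb : b ∈ Set.Ioo (0 : ℝ) 1)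
    (hc : 1 < c) :
    ∀ x : ℝ, x ≠ a + c → ∀ μ : ℝ,
      (rosslerJac a b c 0 0 0).mulVec
          ![1, -((b + 1) * (a + c) / (a + c - x) ^ 2), (b + 1) * (a + c) / (a + c - x) ^ 2] ≠
        μ • ![1, -((b + 1) * (a + c) / (a + c - x) ^ 2), (b + 1) * (a + c) / (a + c - x) ^ 2] ∧
      (rosslerJac a b c (c - a * b) (b - c / a) (c / a - b)).mulVec
          ![1, -((b + 1) * (a + c) / (a + c - x) ^ 2), (b + 1) * (a + c) / (a + c - x) ^ 2] ≠
        μ • ![1, -((b + 1) * (a + c) / (a + c - x) ^ 2), (b + 1) * (a + c) / (a + c - x) ^ 2] := by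
  intro x _ μ
  have hac : a * b < c := by nlinarith [ha.1, ha.2, hb.1, hb.2]
  constructor
  · intro h
    obtain ⟨h1, h2⟩ := rosslerJac_mulVec_eq_smul h
    refine hac.ne ?_
    linear_combination a * h2 + c * h1
  · intro h
    obtain ⟨h1, h2⟩ := rosslerJac_mulVec_eq_smul h
    have hca : a * (c / a) = c := mul_div_cancel₀ c ha.1.ne'
    refine hac.ne ?_
    linear_combination -a * h2 + hca - a * b * h1
end

section
/- Let a, b, c ∈ ℝ with a ∈ (0,1), b ∈ (0,1), c > 1. Let x₀ ∈ ℝ satisfy x₀ < 0 or c−ab < x₀ < a+c, set s = σ(x₀), and let γ : ℝ → ℝ³ be a solution of the Rössler system with γ(0) = s. Then there exists ε > 0 such that for every t with 0 < |t| < ε, the point γ(t) satisfies simultaneously −γ₂(t) − γ₃(t) > 0, γ₁(t) + a·γ₂(t) < 0, and b·γ₁(t) + γ₃(t)·(γ₁(t) − c) > 0 (i.e., γ(t) lies in {ẋ>0} ∩ {ẏ<0} ∩ {ż>0}). -/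
/-- The strict second-derivative test at a zero of the function. -/
theorem eventually_pos_of_hasDerivAt_of_hasDerivAt_pos {f g : ℝ → ℝ} {d : ℝ}
    (hf : ∀ t, HasDerivAt f (g t) t) (hg : HasDerivAt g d 0) (hd : 0 < d)
    (hf0 : f 0 = 0) (hg0 : g 0 = 0) : ∀ᶠ t in nhds (0 : ℝ), t ≠ 0 → 0 < f t := by
  have h1 : ∀ t, HasDerivAt (fun t => f t - d / 4 * t ^ 2) (g t - d / 2 * t) t := fun t =>
    ((hf t).sub ((hasDerivAt_pow 2 t).const_mul (d / 4))).congr_deriv (by push_cast; ring)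
  have h2 : HasDerivAt (fun t => g t - d / 2 * t) (d / 2) 0 :=
    (hg.sub ((hasDerivAt_id (0 : ℝ)).const_mul (d / 2))).congr_deriv (by ring)
  have h3 : deriv (fun t => f t - d / 4 * t ^ 2) = fun t => g t - d / 2 * t :=
    funext fun t => (h1 t).deriv
  have hmin : IsLocalMin (fun t => f t - d / 4 * t ^ 2) 0 := by
    refine isLocalMin_of_deriv_deriv_pos ?_ ?_ (h1 0).continuousAt
    · rw [h3, h2.deriv]
      positivity
    · rw [h3]
      simp [hg0]
  filter_upwards [hmin] with t ht ht0
  simp only [hf0] at ht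
  have : 0 < d / 4 * t ^ 2 := by positivity
  linarith

/-- On the two branches of the tangency curve under consideration, `y` is decreasing. -/
theorem tangency_dy_neg {a b c x₀ : ℝ} (ha : a ∈ Set.Ioo (0 : ℝ) 1)
    (hb : b ∈ Set.Ioo (0 : ℝ) 1) (hc : 1 < c)
    (hx₀ : x₀ < 0 ∨ (c - a * b < x₀ ∧ x₀ < a + c)) :
    0 < a + c - x₀ ∧ x₀ + a * -(x₀ * (b + 1) / (a + c - x₀)) < 0 := by
  obtain ⟨ha0, ha1⟩ := ha
  obtain ⟨hb0, hb1⟩ := hb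
  have hab : a * b < 1 := by nlinarith
  have hD : 0 < a + c - x₀ := by rcases hx₀ with h | h <;> linarith
  refine ⟨hD, ?_⟩
  have e : x₀ + a * -(x₀ * (b + 1) / (a + c - x₀))
      = x₀ * (c - a * b - x₀) / (a + c - x₀) := by
    field_simp
    ring
  rw [e]
  refine div_neg_of_neg_of_pos ?_ hD
  rcases hx₀ with h | h
  · exact mul_neg_of_neg_of_pos h (by linarith)
  · exact mul_neg_of_pos_of_neg (by linarith) (by linarith)

/-- For `x₀ < 0` or `c−ab < x₀ < a+c`, a solution through `s = σ(x₀)` satisfies, for all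
small `t ≠ 0`, `γ(t) ∈ {ẋ>0} ∩ {ẏ<0} ∩ {ż>0}`. -/
theorem stmt_5 (a b c : ℝ) (ha : a ∈ Set.Ioo (0 : ℝ) 1) (hb : b ∈ Set.Ioo (0 : ℝ) 1)
    (hc : 1 < c) (x₀ : ℝ) (hx₀ : x₀ < 0 ∨ (c - a * b < x₀ ∧ x₀ < a + c))
    (γ : ℝ → ℝ × ℝ × ℝ)
    (hsol : ∀ t : ℝ, HasDerivAt γ (rossler a b c (γ t)) t)
    (h0 : γ 0 = (x₀, -(x₀ * (b + 1) / (a + c - x₀)), x₀ * (b + 1) / (a + c - x₀))) :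
    ∃ ε > 0, ∀ t : ℝ, 0 < |t| → |t| < ε →
      0 < -(γ t).2.1 - (γ t).2.2 ∧
      (γ t).1 + a * (γ t).2.1 < 0 ∧
      0 < b * (γ t).1 + (γ t).2.2 * ((γ t).1 - c) := by
  obtain ⟨hD, hy⟩ := tangency_dy_neg ha hb hc hx₀
  have hk : x₀ * (b + 1) / (a + c - x₀) * (a + c - x₀) = x₀ * (b + 1) :=
    div_mul_cancel₀ _ hD.ne'
  generalize x₀ * (b + 1) / (a + c - x₀) = k at h0 hy hk
  have hdx : ∀ t, HasDerivAt (fun t => (γ t).1) (-(γ t).2.1 - (γ t).2.2) t :=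
    fun t => (hsol t).fst
  have hdy : ∀ t, HasDerivAt (fun t => (γ t).2.1) ((γ t).1 + a * (γ t).2.1) t :=
    fun t => (hsol t).snd.fst
  have hdz : ∀ t, HasDerivAt (fun t => (γ t).2.2)
      (b * (γ t).1 + (γ t).2.2 * ((γ t).1 - c)) t :=
    fun t => (hsol t).snd.snd
  have hddy : ∀ t, HasDerivAt (fun t => (γ t).1 + a * (γ t).2.1) _ t :=
    fun t => (hdx t).add ((hdy t).const_mul a)
  have hddz : ∀ t, HasDerivAt (fun t => b * (γ t).1 + (γ t).2.2 * ((γ t).1 - c)) _ t :=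
    fun t => ((hdx t).const_mul b).add ((hdz t).mul ((hdx t).sub_const c))
  have hx_pos : ∀ᶠ t in nhds (0 : ℝ), t ≠ 0 → 0 < -(γ t).2.1 - (γ t).2.2 := by
    refine eventually_pos_of_hasDerivAt_of_hasDerivAt_pos
      (fun t => (hdy t).neg.sub (hdz t)) ((hddy 0).neg.sub (hddz 0)) ?_ ?_ ?_
    · have hz : b * x₀ + k * (x₀ - c) = -(x₀ + a * -k) := by linarith
      simp only [h0, hz]
      linarith [mul_pos_of_neg_of_neg hy (neg_neg_of_pos hD)]
    · simp [h0]
    · simp only [h0]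
      linarith
  have hy_neg : ∀ᶠ t in nhds (0 : ℝ), (γ t).1 + a * (γ t).2.1 < 0 :=
    (hddy 0).continuousAt.eventually_lt continuousAt_const (by simpa only [h0] using hy)
  have hz_pos : ∀ᶠ t in nhds (0 : ℝ), 0 < b * (γ t).1 + (γ t).2.2 * ((γ t).1 - c) :=
    continuousAt_const.eventually_lt (hddz 0).continuousAt (by simp only [h0]; linarith)
  obtain ⟨ε, hε, h⟩ := Metric.eventually_nhds_iff.1 (hx_pos.and (hy_neg.and hz_pos))
  refine ⟨ε, hε, fun t ht htε => ?_⟩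
  obtain ⟨h1, h2, h3⟩ := h (y := t) (by simpa using htε)
  exact ⟨h1 (abs_pos.1 ht), h2, h3⟩
end

section
/- Let a, b, c ∈ ℝ with a ∈ (0,1), b ∈ (0,1), c > 1. For every x ≠ a+c, one has F_{a,b,c}(σ(x)) = (0, x(c−ab−x)/(a+c−x), −x(c−ab−x)/(a+c−x)). In particular, for every x with 0 < x < c−ab or x > a+c, the point σ(x) lies in {ẏ>0}, i.e., σ(x)₁ + a·σ(x)₂ > 0; and for every x with x < 0 or c−ab < x < a+c, the point σ(x) lies in {ẏ<0} ∩ {ż>0}. -/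
theorem rossler_tangency_ydot {a b c x : ℝ} (h : a + c - x ≠ 0) :
    x + a * (-(x * (b + 1) / (a + c - x))) = x * (c - a * b - x) / (a + c - x) := by
  field_simp
  ring

theorem rossler_tangency_zdot {a b c x : ℝ} (h : a + c - x ≠ 0) :
    b * x + (x * (b + 1) / (a + c - x)) * (x - c) =
      -(x * (c - a * b - x) / (a + c - x)) := by
  field_simp
  ring

/-- For `x ≠ a+c`, `F(σ(x)) = (0, x(c−ab−x)/(a+c−x), −x(c−ab−x)/(a+c−x))`.  In particular,
for `0 < x < c−ab` or `x > a+c` the point `σ(x)` lies in `{ẏ>0}`, and for `x < 0` or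
`c−ab < x < a+c` it lies in `{ẏ<0} ∩ {ż>0}`. -/
theorem stmt_6 (a b c : ℝ) (ha : a ∈ Set.Ioo (0 : ℝ) 1) (hb : b ∈ Set.Ioo (0 : ℝ) 1)
    (hc : 1 < c) :
    ∀ x : ℝ, x ≠ a + c →
      rossler a b c (x, -(x * (b + 1) / (a + c - x)), x * (b + 1) / (a + c - x)) =
        (0, x * (c - a * b - x) / (a + c - x), -(x * (c - a * b - x) / (a + c - x))) ∧
      ((0 < x ∧ x < c - a * b) ∨ a + c < x →
        0 < x + a * (-(x * (b + 1) / (a + c - x)))) ∧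
      (x < 0 ∨ (c - a * b < x ∧ x < a + c) →
        x + a * (-(x * (b + 1) / (a + c - x))) < 0 ∧
        0 < b * x + (x * (b + 1) / (a + c - x)) * (x - c)) := by
  obtain ⟨ha0, ha1⟩ := ha
  obtain ⟨hb0, hb1⟩ := hb
  intro x hx
  have hd : a + c - x ≠ 0 := sub_ne_zero.mpr hx.symm
  have hab : 0 < a * b := mul_pos ha0 hb0
  have hab1 : a * b < 1 := mul_lt_one_of_nonneg_of_lt_one_left ha0.le ha1 hb1.le
  refine ⟨?_, ?_, ?_⟩
  · simp only [rossler, rossler_tangency_ydot hd, rossler_tangency_zdot hd, neg_neg, sub_self]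
  · rw [rossler_tangency_ydot hd]
    rintro (⟨h0, h1⟩ | h)
    · exact div_pos (mul_pos h0 (by linarith)) (by linarith)
    · exact div_pos_of_neg_of_neg
        (mul_neg_of_pos_of_neg (by linarith) (by linarith)) (by linarith)
  · rw [rossler_tangency_ydot hd, rossler_tangency_zdot hd, neg_pos, and_self_iff]
    rintro (h | ⟨h0, h1⟩)
    · exact div_neg_of_neg_of_pos (mul_neg_of_neg_of_pos h (by linarith)) (by linarith)
    · exact div_neg_of_neg_of_pos
        (mul_neg_of_pos_of_neg (by linarith) (by linarith)) (by linarith)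
end

section
/- Let a, b, c ∈ ℝ with a ∈ (0,1), b ∈ (0,1), c > 1. (i) Let x₀ ∈ ℝ satisfy x₀ < 0 or x₀ > c−ab, set s = l_p(x₀) = (x₀, −x₀/a, x₀/a), and let γ : ℝ → ℝ³ be a solution of the Rössler system with γ(0) = s. Then there exists ε > 0 such that for every t with 0 < |t| < ε, one has γ₁(t) + a·γ₂(t) < 0 and b·γ₁(t) + γ₃(t)·(γ₁(t) − c) > 0 (i.e., γ(t) ∈ {ẏ<0} ∩ {ż>0}). (ii) For every x with 0 < x < c−ab, the point l_p(x) lies in {ż<0}, i.e., bx + (x/a)(x−c) < 0. -/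
open Filter Topology in
/-- Strict second-derivative test: if `u` and `u' = g` vanish at `0` and `g` has negative derivative
there, then `u` is negative on a punctured neighbourhood of `0`. -/
theorem eventually_neg_of_second_deriv_neg {u g : ℝ → ℝ} {k : ℝ}
    (hu : ∀ t, HasDerivAt u (g t) t) (hg : HasDerivAt g k 0) (hu0 : u 0 = 0) (hg0 : g 0 = 0)
    (hk : k < 0) : ∀ᶠ t in 𝓝[≠] 0, u t < 0 := by
  have h1 : ∀ᶠ t in 𝓝[≠] (0 : ℝ), slope g 0 t < 0 :=
    (hasDerivAt_iff_tendsto_slope.1 hg).eventually (gt_mem_nhds hk)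
  rw [eventually_nhdsWithin_iff, Metric.eventually_nhds_iff] at h1 ⊢
  obtain ⟨ε, hε, h⟩ := h1
  refine ⟨ε, hε, fun t ht ht0 => ?_⟩
  rw [Real.dist_eq, sub_zero, abs_lt] at ht
  have hcont : Continuous u := continuous_iff_continuousAt.2 fun t => (hu t).continuousAt
  have hsl : ∀ x, -ε < x → x < ε → x ≠ 0 → g x / x < 0 := fun x hx1 hx2 hx0 => by
    have := h (y := x) (by rw [Real.dist_eq, sub_zero, abs_lt]; exact ⟨hx1, hx2⟩) hx0
    rwa [slope_def_field, hg0, sub_zero, sub_zero] at this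
  rcases lt_or_gt_of_ne (show t ≠ 0 from ht0) with hneg | hpos
  · obtain ⟨x, hx, hxe⟩ :=
      exists_hasDerivAt_eq_slope u g hneg hcont.continuousOn fun x _ => hu x
    have hgx : 0 < g x := by
      have := hsl x (by linarith [hx.1]) (by linarith [hx.2]) hx.2.ne
      by_contra! hle
      exact absurd (div_nonneg_of_nonpos hle hx.2.le) this.not_ge
    rw [hxe, hu0, lt_div_iff₀ (by linarith)] at hgx
    linarith
  · obtain ⟨x, hx, hxe⟩ :=
      exists_hasDerivAt_eq_slope u g hpos hcont.continuousOn fun x _ => hu x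
    have hgx : g x < 0 := by
      have := hsl x (by linarith [hx.1]) (by linarith [hx.2]) hx.1.ne'
      by_contra! hle
      exact absurd (div_nonneg hle hx.1.le) this.not_ge
    rw [hxe, hu0, div_lt_iff₀ (by linarith)] at hgx
    linarith

/-- (i) For `x₀ < 0` or `x₀ > c−ab`, a solution through `l_p(x₀) = (x₀, −x₀/a, x₀/a)`
satisfies `γ(t) ∈ {ẏ<0} ∩ {ż>0}` for all small `t ≠ 0`.
(ii) For `0 < x < c−ab`, the point `l_p(x)` lies in `{ż<0}`. -/
theorem stmt_8 (a b c : ℝ) (ha : a ∈ Set.Ioo (0 : ℝ) 1) (hb : b ∈ Set.Ioo (0 : ℝ) 1)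
    (hc : 1 < c) :
    (∀ x₀ : ℝ, x₀ < 0 ∨ c - a * b < x₀ →
      ∀ γ : ℝ → ℝ × ℝ × ℝ, (∀ t : ℝ, HasDerivAt γ (rossler a b c (γ t)) t) →
        γ 0 = (x₀, -x₀ / a, x₀ / a) →
        ∃ ε > 0, ∀ t : ℝ, 0 < |t| → |t| < ε →
          (γ t).1 + a * (γ t).2.1 < 0 ∧
          0 < b * (γ t).1 + (γ t).2.2 * ((γ t).1 - c)) ∧
    (∀ x : ℝ, 0 < x → x < c - a * b → b * x + (x / a) * (x - c) < 0) := by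
  obtain ⟨ha0, ha1⟩ := ha
  obtain ⟨hb0, hb1⟩ := hb
  have hfac : ∀ x : ℝ, b * x + (x / a) * (x - c) = x * (x - (c - a * b)) / a := fun x => by
    field_simp
    ring
  refine ⟨fun x₀ hx₀ γ hγ h0 => ?_, fun x hx hxc => ?_⟩
  · have hab : 0 < c - a * b := by nlinarith
    have hz0 : 0 < b * x₀ + (x₀ / a) * (x₀ - c) := by
      rw [hfac]
      refine div_pos ?_ ha0
      rcases hx₀ with h | h
      · exact mul_pos_of_neg_of_neg h (by linarith)
      · exact mul_pos (by linarith) (by linarith)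
    have hX : ∀ t, HasDerivAt (fun t => (γ t).1) (-(γ t).2.1 - (γ t).2.2) t :=
      fun t => (hγ t).fst
    have hY : ∀ t, HasDerivAt (fun t => (γ t).2.1) ((γ t).1 + a * (γ t).2.1) t :=
      fun t => (hγ t).snd.fst
    have hZ : ∀ t, HasDerivAt (fun t => (γ t).2.2)
        (b * (γ t).1 + (γ t).2.2 * ((γ t).1 - c)) t :=
      fun t => (hγ t).snd.snd
    have hU t := (hX t).add ((hY t).const_mul a)
    have hG := (((hY 0).neg.sub (hZ 0)).add ((hU 0).const_mul a))
    have hneg := eventually_neg_of_second_deriv_neg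
      (fun t => (hU t).congr_deriv (g' := -(γ t).2.1 - (γ t).2.2 + a * ((γ t).1 + a * (γ t).2.1))
        rfl) hG
      (by simp only [Pi.add_apply, h0]; field_simp; ring)
      (by simp only [h0]; field_simp; ring)
      (by
        simp only [h0]
        have h1 : x₀ + a * (-x₀ / a) = 0 := by field_simp; ring
        have h2 : -(-x₀ / a) - x₀ / a = 0 := by ring
        rw [h1, h2]
        linarith)
    have hpos : ∀ᶠ t in nhds (0 : ℝ), 0 < b * (γ t).1 + (γ t).2.2 * ((γ t).1 - c) := by
      refine ContinuousAt.eventually_lt continuousAt_const ?_ (by simpa only [h0] using hz0)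
      exact ((hX 0).continuousAt.const_mul b).add
        ((hZ 0).continuousAt.mul ((hX 0).continuousAt.sub continuousAt_const))
    rw [eventually_nhdsWithin_iff] at hneg
    obtain ⟨ε, hε, h⟩ := Metric.eventually_nhds_iff.1 (hneg.and hpos)
    refine ⟨ε, hε, fun t ht htε => ?_⟩
    have := h (y := t) (by rwa [Real.dist_eq, sub_zero])
    exact ⟨this.1 (abs_pos.1 ht), this.2⟩
  · rw [hfac]
    exact div_neg_of_neg_of_pos (mul_neg_of_pos_of_neg hx (by linarith)) ha0
end

section
/- Let a, b, c ∈ ℝ with b > 0 and c > 0. Then for all x, y ∈ ℝ, the third component of F_{a,b,c}(x, y, −b) equals bc > 0; consequently, no trajectory enters the set B = {(x,y,z) ∈ ℝ³ : z < −b} under the flow: if γ : ℝ → ℝ³ is a solution of the Rössler system with γ₃(0) ≥ −b, then γ₃(t) ≥ −b for all t ≥ 0. -/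
/-- On the plane `{z = −b}`, the third component of the Rössler field equals `bc > 0`;
consequently no trajectory enters `B = {z < −b}` under the flow: a solution starting with
`z`-coordinate `≥ −b` keeps `z`-coordinate `≥ −b` for all forward time. -/
theorem stmt_9 (a b c : ℝ) (hb : 0 < b) (hc : 0 < c) :
    (∀ x y : ℝ, (rossler a b c (x, y, -b)).2.2 = b * c ∧ 0 < b * c) ∧
    ∀ γ : ℝ → ℝ × ℝ × ℝ, (∀ t : ℝ, HasDerivAt γ (rossler a b c (γ t)) t) →
      -b ≤ (γ 0).2.2 → ∀ t : ℝ, 0 ≤ t → -b ≤ (γ t).2.2 := by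
  refine ⟨fun x y => ⟨by simp only [rossler]; ring, mul_pos hb hc⟩, fun γ hγ h0 t ht => ?_⟩
  have hz (s : ℝ) : HasDerivAt (fun s => -(γ s).2.2) (-(rossler a b c (γ s)).2.2) s :=
    (((ContinuousLinearMap.snd ℝ ℝ ℝ).comp (ContinuousLinearMap.snd ℝ ℝ (ℝ × ℝ))).hasFDerivAt.comp_hasDerivAt
      s (hγ s)).neg
  have key : -(γ t).2.2 ≤ b :=
    image_le_of_deriv_right_lt_deriv_boundary (f := fun s => -(γ s).2.2)
      (f' := fun s => -(rossler a b c (γ s)).2.2) (B := fun _ => b) (B' := fun _ => 0)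
      (fun s _ => (hz s).continuousAt.continuousWithinAt)
      (fun s _ => (hz s).hasDerivWithinAt) (by linarith) (fun s => hasDerivAt_const s b)
      (fun s _ hs => by
        have hs' : (γ s).2.2 = -b := by linarith
        simp only [rossler, hs']
        nlinarith [mul_pos hb hc])
      (Set.right_mem_Icc.mpr ht)
  linarith
end

section
/- Let a, b, c ∈ ℝ with a ∈ (0,1), b ∈ (0,1), c > 1. For every x ≠ c, the inner product F_{a,b,c}(Δ(x)) ⬝ (0,1,1) equals x·(x − c + ab)/(x − c). In particular, it is strictly negative if and only if x < 0 or c−ab < x < c, and strictly positive if and only if 0 < x < c−ab or x > c. -/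
/-- Euclidean inner product on `ℝ³` (as `ℝ × ℝ × ℝ`). -/
noncomputable def dot3 (u v : ℝ × ℝ × ℝ) : ℝ :=
  u.1 * v.1 + u.2.1 * v.2.1 + u.2.2 * v.2.2

/-- Along the curve `Δ(x) = (x, bx/(x−c), bx/(c−x))`, `x ≠ c`, the inner product of the
Rössler field with `(0,1,1)` equals `x(x − c + ab)/(x − c)`; it is negative iff `x < 0` or
`c−ab < x < c`, and positive iff `0 < x < c−ab` or `x > c`. -/
theorem stmt_12 (a b c : ℝ) (ha : a ∈ Set.Ioo (0 : ℝ) 1) (hb : b ∈ Set.Ioo (0 : ℝ) 1)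
    (hc : 1 < c) :
    ∀ x : ℝ, x ≠ c →
      dot3 (rossler a b c (x, b * x / (x - c), b * x / (c - x))) (0, 1, 1) =
        x * (x - c + a * b) / (x - c) ∧
      (x * (x - c + a * b) / (x - c) < 0 ↔ x < 0 ∨ (c - a * b < x ∧ x < c)) ∧
      (0 < x * (x - c + a * b) / (x - c) ↔ (0 < x ∧ x < c - a * b) ∨ c < x) := by
  intro x hx
  obtain ⟨ha0, ha1⟩ := ha
  obtain ⟨hb0, hb1⟩ := hb
  have hab : 0 < a * b := mul_pos ha0 hb0
  have habc : a * b < c := (mul_lt_one_of_nonneg_of_lt_one_left ha0.le ha1 hb1.le).trans hc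
  have hxc : x - c ≠ 0 := sub_ne_zero.mpr hx
  refine ⟨?_, ?_, ?_⟩
  · rw [← neg_sub x c]
    simp only [dot3, rossler]
    field_simp
    ring
  · rw [div_neg_iff, mul_pos_iff, mul_neg_iff]
    grind
  · rw [div_pos_iff, mul_pos_iff, mul_neg_iff]
    grind
end

section
/- Let a, b, c ∈ ℝ with a ∈ (0,1), b ∈ (0,1), c > 1. Then the vector (1, −1/a, 1/a) (the direction of the tangency line l_p) is not an eigenvector of the Jacobian matrix J_{a,b,c}(P_In) of F_{a,b,c} at P_In = (0,0,0), and is not an eigenvector of the Jacobian matrix J_{a,b,c}(P_Out) at P_Out = (c−ab, b−c/a, c/a−b); that is, for every μ ∈ ℝ, J_{a,b,c}(P_In)·(1,−1/a,1/a) ≠ μ·(1,−1/a,1/a) and J_{a,b,c}(P_Out)·(1,−1/a,1/a) ≠ μ·(1,−1/a,1/a). -/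
/-- The direction `(1, −1/a, 1/a)` of the tangency line `l_p` is not an eigenvector of the
Jacobian of the Rössler field at `P_In = (0,0,0)` nor at `P_Out = (c−ab, b−c/a, c/a−b)`. -/
theorem stmt_13 (a b c : ℝ) (ha : a ∈ Set.Ioo (0 : ℝ) 1) (hb : b ∈ Set.Ioo (0 : ℝ) 1)
    (hc : 1 < c) :
    ∀ μ : ℝ,
      (rosslerJac a b c 0 0 0).mulVec ![1, -(1 / a), 1 / a] ≠
        μ • ![1, -(1 / a), 1 / a] ∧
      (rosslerJac a b c (c - a * b) (b - c / a) (c / a - b)).mulVec ![1, -(1 / a), 1 / a] ≠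
        μ • ![1, -(1 / a), 1 / a] := by
  obtain ⟨ha0, ha1⟩ := ha
  obtain ⟨-, hb1⟩ := hb
  have hba : b < c / a := by
    rw [lt_div_iff₀ ha0]
    nlinarith
  intro μ
  constructor <;> intro h
  all_goals
    have h0 := congrFun h 0
    have h2 := congrFun h 2
    simp [rosslerJac, Matrix.mulVec, dotProduct, Fin.sum_univ_three] at h0 h2
    subst h0
  · rw [zero_mul, ← div_eq_mul_inv] at h2
    linarith
  · field_simp at h2 hba
    linarith
end

section
/- Let (a,b,c) = (0.468, 0.3, 4.615). Then the characteristic polynomial of the Jacobian matrix J_{a,b,c}(P_In) at P_In = (0,0,0) factors as (X − γ)·(X² − 2ρX + (ρ² + ω²)) for some real numbers γ, ρ, ω with γ < 0, ρ > 0 and ω ≠ 0; that is, J_{a,b,c}(P_In) has one real eigenvalue γ_In < 0 and two non-real complex-conjugate eigenvalues ρ_In ± iω_In with ρ_In > 0. Moreover, the saddle index satisfies ν_In = |ρ_In/γ_In| < 1, i.e., ρ < −γ (the Shilnikov condition at P_In). -/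
/-- The characteristic polynomial of the Rössler Jacobian at the origin. -/
lemma rosslerJac_zero_charpoly (a b c : ℝ) :
    (rosslerJac a b c 0 0 0).charpoly =
      Polynomial.X ^ 3 + Polynomial.C (c - a) * Polynomial.X ^ 2 +
        Polynomial.C (1 + b - a * c) * Polynomial.X + Polynomial.C (c - a * b) := by
  simp [rosslerJac, Matrix.charpoly, Matrix.charmatrix, Matrix.det_fin_three]
  ring

/-- A monic cubic satisfying the Vieta relations for roots `γ`, `ρ ± iω` factors over `ℝ`. -/
lemma cubic_eq_linear_mul_quadratic {p q r γ ρ ω : ℝ} (hp : p = -(γ + 2 * ρ))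
    (hq : q = 2 * ρ * γ + (ρ ^ 2 + ω ^ 2)) (hr : r = -γ * (ρ ^ 2 + ω ^ 2)) :
    Polynomial.X ^ 3 + Polynomial.C p * Polynomial.X ^ 2 + Polynomial.C q * Polynomial.X +
        Polynomial.C r =
      (Polynomial.X - Polynomial.C γ) *
        (Polynomial.X ^ 2 - Polynomial.C (2 * ρ) * Polynomial.X +
          Polynomial.C (ρ ^ 2 + ω ^ 2)) := by
  subst hp hq hr
  simp only [map_add, map_mul, map_neg, map_pow]
  ring

/-- At `(a,b,c) = (0.468, 0.3, 4.615)` the characteristic polynomial of the Jacobian at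
`P_In = (0,0,0)` factors as `(X − γ)(X² − 2ρX + (ρ² + ω²))` with `γ < 0`, `ρ > 0`, `ω ≠ 0`:
one negative real eigenvalue and two non-real conjugate eigenvalues with positive real
part.  Moreover the saddle index satisfies `ν_In = |ρ/γ| < 1`, i.e. `ρ < −γ` (the
Shilnikov condition at `P_In`). -/
theorem stmt_15 :
    ∃ γ ρ ω : ℝ, γ < 0 ∧ 0 < ρ ∧ ω ≠ 0 ∧ ρ < -γ ∧
      (rosslerJac 0.468 0.3 4.615 0 0 0).charpoly =
        (Polynomial.X - Polynomial.C γ) *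
          (Polynomial.X ^ 2 - Polynomial.C (2 * ρ) * Polynomial.X +
            Polynomial.C (ρ ^ 2 + ω ^ 2)) := by
  obtain ⟨γ, ⟨hγ₁, hγ₂⟩, hγ⟩ :
      ∃ γ ∈ Set.Ioo (-5 : ℝ) (-4.147),
        γ ^ 3 + 4.147 * γ ^ 2 - 0.85982 * γ + 4.4746 = 0 :=
    intermediate_value_Ioo (f := fun t : ℝ => t ^ 3 + 4.147 * t ^ 2 - 0.85982 * t + 4.4746)
      (by norm_num) (by fun_prop) (by constructor <;> norm_num)
  obtain ⟨ρ, hρ⟩ : ∃ ρ : ℝ, ρ = (-4.147 - γ) / 2 := ⟨_, rfl⟩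
  have hpos : 0 < γ ^ 2 + 4.147 * γ - 0.85982 - ρ ^ 2 := by
    have hquad : 0.89 < γ ^ 2 + 4.147 * γ - 0.85982 := by
      by_contra! h
      nlinarith
    have hsq : ρ ^ 2 < 0.2 := by nlinarith
    linarith
  have hω := Real.sq_sqrt hpos.le
  refine ⟨γ, ρ, √(γ ^ 2 + 4.147 * γ - 0.85982 - ρ ^ 2), by linarith, by linarith,
    (Real.sqrt_pos.mpr hpos).ne', by linarith, ?_⟩
  rw [rosslerJac_zero_charpoly]
  apply cubic_eq_linear_mul_quadratic
  · rw [hρ]; ring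
  · rw [hω, hρ]; ring
  · rw [hω]; linear_combination hγ
end

section
/- Let (a,b,c) = (0.468, 0.3, 4.615). Then the characteristic polynomial of the Jacobian matrix J_{a,b,c}(P_Out) at P_Out = (c−ab, b−c/a, c/a−b) factors as (X − γ)·(X² − 2ρX + (ρ² + ω²)) for some real numbers γ, ρ, ω with γ > 0, ρ < 0 and ω ≠ 0; that is, J_{a,b,c}(P_Out) has one real eigenvalue γ_Out > 0 and two non-real complex-conjugate eigenvalues ρ_Out ± iω_Out with ρ_Out < 0. Moreover, the saddle index satisfies ν_Out = |ρ_Out/γ_Out| < 1, i.e., −ρ < γ (the Shilnikov condition at P_Out). -/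
/-- The characteristic polynomial of the Rössler Jacobian. -/
theorem rosslerJac_charpoly (a b c x y z : ℝ) :
    (rosslerJac a b c x y z).charpoly =
      Polynomial.X * (Polynomial.X - Polynomial.C a) * (Polynomial.X - Polynomial.C (x - c)) +
        (Polynomial.X - Polynomial.C (x - c)) +
        Polynomial.C (b + z) * (Polynomial.X - Polynomial.C a) := by
  rw [Matrix.charpoly, Matrix.det_fin_three]
  simp [rosslerJac]
  ring

/-- At `(a,b,c) = (0.468, 0.3, 4.615)` the characteristic polynomial of the Jacobian at
`P_Out = (c−ab, b−c/a, c/a−b)` factors as `(X − γ)(X² − 2ρX + (ρ² + ω²))` with `γ > 0`,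
`ρ < 0`, `ω ≠ 0`: one positive real eigenvalue and two non-real conjugate eigenvalues with
negative real part.  Moreover the saddle index satisfies `ν_Out = |ρ/γ| < 1`, i.e.
`−ρ < γ` (the Shilnikov condition at `P_Out`). -/
theorem stmt_16 :
    ∃ γ ρ ω : ℝ, 0 < γ ∧ ρ < 0 ∧ ω ≠ 0 ∧ -ρ < γ ∧
      (rosslerJac 0.468 0.3 4.615
          (4.615 - 0.468 * 0.3) (0.3 - 4.615 / 0.468) (4.615 / 0.468 - 0.3)).charpoly =
        (Polynomial.X - Polynomial.C γ) *
          (Polynomial.X ^ 2 - Polynomial.C (2 * ρ) * Polynomial.X +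
            Polynomial.C (ρ ^ 2 + ω ^ 2)) := by
  -- The cubic has a root between `0.4` and `0.5` by the intermediate value theorem.
  obtain ⟨γ, ⟨hγ₁, hγ₂⟩, hγ⟩ : ∃ γ ∈ Set.Icc (0.4 : ℝ) 0.5,
      γ * (γ - 0.468) * (γ + 0.468 * 0.3) + (γ + 0.468 * 0.3) +
        4.615 / 0.468 * (γ - 0.468) = 0 := by
    refine intermediate_value_Icc (f := fun γ : ℝ ↦ γ * (γ - 0.468) * (γ + 0.468 * 0.3) +
      (γ + 0.468 * 0.3) + 4.615 / 0.468 * (γ - 0.468)) (by norm_num)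
      (by fun_prop) ⟨?_, ?_⟩ <;> norm_num
  set ρ : ℝ := (0.468 - 0.468 * 0.3 - γ) / 2 with hρ
  set N : ℝ := 1 + 4.615 / 0.468 - 0.468 * (0.468 * 0.3) - 2 * ρ * γ with hN
  have hpos : 0 < N - ρ ^ 2 := by
    rw [hN, hρ]
    nlinarith
  refine ⟨γ, ρ, √(N - ρ ^ 2), by linarith, by rw [hρ]; linarith, (Real.sqrt_pos.2 hpos).ne',
    by rw [hρ]; linarith, ?_⟩
  rw [rosslerJac_charpoly, Real.sq_sqrt hpos.le]
  refine Polynomial.funext fun t ↦ ?_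
  simp only [Polynomial.eval_add, Polynomial.eval_sub, Polynomial.eval_mul, Polynomial.eval_pow,
    Polynomial.eval_X, Polynomial.eval_C]
  rw [hN, hρ]
  linear_combination hγ
end

section
/- Let a, b, c ∈ ℝ with a ∈ (0,1), b ∈ (0,1), c > 1. Then there exists R > 0 such that for every v ∈ ℝ³ with ‖v‖ ≥ R, the vector F_{a,b,c}(v) does not point in the direction (0,0,−d) for any d > 0; that is, it is not the case that the first and second components of F_{a,b,c}(v) vanish while the third is strictly negative. (Indeed, F_{a,b,c}(v) is a negative multiple of (0,0,1) only at points v = (x, −x/a, x/a) of the line l_p with 0 < x < c−ab, a bounded set.) -/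
/-- For all points `v` of sufficiently large Euclidean norm, the Rössler vector field at
`v` does not point in the direction `(0,0,−d)`, `d > 0`: it is not the case that the first
two components of `F(v)` vanish while the third is strictly negative. -/
theorem stmt_19 (a b c : ℝ) (ha : a ∈ Set.Ioo (0 : ℝ) 1) (hb : b ∈ Set.Ioo (0 : ℝ) 1)
    (hc : 1 < c) :
    ∃ R : ℝ, 0 < R ∧ ∀ v : ℝ × ℝ × ℝ,
      R ≤ Real.sqrt (v.1 ^ 2 + v.2.1 ^ 2 + v.2.2 ^ 2) →
      ¬((rossler a b c v).1 = 0 ∧ (rossler a b c v).2.1 = 0 ∧ (rossler a b c v).2.2 < 0) := by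
  obtain ⟨ha0, ha1⟩ := ha
  obtain ⟨hb0, hb1⟩ := hb
  refine ⟨2 * (c / a), by positivity, ?_⟩
  rintro ⟨x, y, z⟩ hR ⟨h₁, h₂, h₃⟩
  simp only [rossler] at hR h₁ h₂ h₃
  obtain rfl : y = -z := by linarith
  obtain rfl : x = a * z := by linarith
  have hab : a * b < c := by nlinarith
  have hneg : z * (a * z - (c - a * b)) < 0 := by linarith
  have hz : 0 < z := by
    by_contra! hz
    nlinarith [mul_nonneg_of_nonpos_of_nonpos hz
      (show a * z - (c - a * b) ≤ 0 by nlinarith)]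
  have hzc : z < c / a := by
    rw [lt_div_iff₀ ha0]
    nlinarith [neg_of_mul_neg_right hneg hz.le, mul_pos ha0 hb0]
  have hsq := (Real.le_sqrt' (by positivity)).mp hR
  have hz2 : z ^ 2 < (c / a) ^ 2 := by gcongr
  have haz : (a * z) ^ 2 ≤ z ^ 2 := by
    gcongr
    nlinarith
  nlinarith [sq_nonneg z]
end
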